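/- arXiv:1410.3011 — 4 statements merged into one kernel-verified Lean document; each statement's English description precedes it below -/
import Mathlib

section
/- Let a₀, a₁, a₂, a₃ ∈ ℝ, let r₀, r₁, r₂, r₃ : [t₀,∞) → ℝ, let μ ∈ ℝ be a root of the quartic λ⁴ + a₃λ³ + a₂λ² + a₁λ + a₀, and let y : [t₀,∞) → ℝ be four times differentiable with y(t) > 0 for all t ≥ t₀ and satisfying the perturbed fourth-order equation. Then z := y′/y − μ is three times differentiable on [t₀,∞) and satisfies the Riccati-type equation R(μ). -/
open Set

/-- Iterated one-sided (within `[t₀,∞)`) derivative. -/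
noncomputable def iterDW (t0 : ℝ) (f : ℝ → ℝ) : ℕ → ℝ → ℝ
  | 0 => f
  | n + 1 => derivWithin (iterDW t0 f n) (Ici t0)

/-- If the `n`-th iterated derivative of `f` agrees on `[t₀,∞)` with `g` and `g` has derivative `g'`
there, then it is differentiable and the next iterated derivative agrees with `g'`. -/
theorem iterDW_succ_of_eqOn {t₀ : ℝ} {f g g' : ℝ → ℝ} {n : ℕ}
    (h : EqOn (iterDW t₀ f n) g (Ici t₀))
    (hg : ∀ t ∈ Ici t₀, HasDerivWithinAt g (g' t) (Ici t₀) t) :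
    (∀ t ∈ Ici t₀, DifferentiableWithinAt ℝ (iterDW t₀ f n) (Ici t₀) t) ∧
      EqOn (iterDW t₀ f (n + 1)) g' (Ici t₀) := by
  have key : ∀ t ∈ Ici t₀, HasDerivWithinAt (iterDW t₀ f n) (g' t) (Ici t₀) t :=
    fun t ht => (hg t ht).congr h (h ht)
  exact ⟨fun t ht => (key t ht).differentiableWithinAt,
    fun t ht => (key t ht).derivWithin (uniqueDiffOn_Ici t₀ t ht)⟩

/-- The quotients `p k = y⁽ᵏ⁾ / y` satisfy `(p k)' = p (k + 1) - p k * p 1`. -/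
theorem hasDerivWithinAt_iterDW_div {t₀ t : ℝ} {y : ℝ → ℝ} {k : ℕ}
    (hy : DifferentiableWithinAt ℝ y (Ici t₀) t)
    (hk : DifferentiableWithinAt ℝ (iterDW t₀ y k) (Ici t₀) t) (h0 : y t ≠ 0) :
    HasDerivWithinAt (fun s => iterDW t₀ y k s / y s)
      (iterDW t₀ y (k + 1) t / y t - iterDW t₀ y k t / y t * (iterDW t₀ y 1 t / y t))
      (Ici t₀) t := by
  refine (hk.hasDerivWithinAt.div hy.hasDerivWithinAt h0).congr_deriv ?_
  simp only [iterDW]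
  field_simp

/-- if `y > 0` is a four times differentiable solution on `[t₀,∞)` of the
perturbed fourth-order equation and `μ` is a root of the characteristic quartic, then
`z = y'/y − μ` is three times differentiable on `[t₀,∞)` and satisfies the Riccati-type
equation `R(μ)`. -/
theorem stmt_1 (t₀ a₀ a₁ a₂ a₃ μ : ℝ) (r₀ r₁ r₂ r₃ : ℝ → ℝ) (y : ℝ → ℝ)
    (hμ : μ ^ 4 + a₃ * μ ^ 3 + a₂ * μ ^ 2 + a₁ * μ + a₀ = 0)
    (hdiff : ∀ k < 4, ∀ t ∈ Ici t₀, DifferentiableWithinAt ℝ (iterDW t₀ y k) (Ici t₀) t)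
    (hpos : ∀ t ∈ Ici t₀, 0 < y t)
    (hode : ∀ t ∈ Ici t₀,
      iterDW t₀ y 4 t + (a₃ + r₃ t) * iterDW t₀ y 3 t + (a₂ + r₂ t) * iterDW t₀ y 2 t
        + (a₁ + r₁ t) * iterDW t₀ y 1 t + (a₀ + r₀ t) * y t = 0) :
    (∀ k < 3, ∀ t ∈ Ici t₀,
        DifferentiableWithinAt ℝ
          (iterDW t₀ (fun s => iterDW t₀ y 1 s / y s - μ) k) (Ici t₀) t) ∧
    (∀ t ∈ Ici t₀,
      iterDW t₀ (fun s => iterDW t₀ y 1 s / y s - μ) 3 t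
        + (4 * μ + a₃) * iterDW t₀ (fun s => iterDW t₀ y 1 s / y s - μ) 2 t
        + (6 * μ ^ 2 + 3 * a₃ * μ + a₂) * iterDW t₀ (fun s => iterDW t₀ y 1 s / y s - μ) 1 t
        + (4 * μ ^ 3 + 3 * a₃ * μ ^ 2 + 2 * a₂ * μ + a₁) * (iterDW t₀ y 1 t / y t - μ)
        + r₃ t * iterDW t₀ (fun s => iterDW t₀ y 1 s / y s - μ) 2 t
        + (3 * μ * r₃ t + r₂ t) * iterDW t₀ (fun s => iterDW t₀ y 1 s / y s - μ) 1 t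
        + (3 * μ ^ 2 * r₃ t + 2 * μ * r₂ t + r₁ t) * (iterDW t₀ y 1 t / y t - μ)
        + μ ^ 3 * r₃ t + μ ^ 2 * r₂ t + μ * r₁ t + r₀ t
        + 4 * (iterDW t₀ y 1 t / y t - μ) * iterDW t₀ (fun s => iterDW t₀ y 1 s / y s - μ) 2 t
        + (12 * μ + 3 * a₃ + 3 * r₃ t) * (iterDW t₀ y 1 t / y t - μ)
            * iterDW t₀ (fun s => iterDW t₀ y 1 s / y s - μ) 1 t
        + 6 * (iterDW t₀ y 1 t / y t - μ) ^ 2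
            * iterDW t₀ (fun s => iterDW t₀ y 1 s / y s - μ) 1 t
        + 3 * (iterDW t₀ (fun s => iterDW t₀ y 1 s / y s - μ) 1 t) ^ 2
        + (6 * μ ^ 2 + 3 * μ * a₃ + a₂ + 3 * μ * r₃ t + r₂ t)
            * (iterDW t₀ y 1 t / y t - μ) ^ 2
        + (4 * μ + a₃ + r₃ t) * (iterDW t₀ y 1 t / y t - μ) ^ 3
        + (iterDW t₀ y 1 t / y t - μ) ^ 4 = 0) := by
  let p : ℕ → ℝ → ℝ := fun k s => iterDW t₀ y k s / y s
  have hp : ∀ k < 4, ∀ t ∈ Ici t₀,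
      HasDerivWithinAt (p k) (p (k + 1) t - p k t * p 1 t) (Ici t₀) t := fun k hk t ht =>
    hasDerivWithinAt_iterDW_div (hdiff 0 (by norm_num) t ht) (hdiff k hk t ht) (hpos t ht).ne'
  have hode' : ∀ t ∈ Ici t₀, iterDW t₀ y 4 t / y t + (a₃ + r₃ t) * (iterDW t₀ y 3 t / y t)
      + (a₂ + r₂ t) * (iterDW t₀ y 2 t / y t) + (a₁ + r₁ t) * (iterDW t₀ y 1 t / y t)
      + (a₀ + r₀ t) = 0 := by
    intro t ht
    have h0 := (hpos t ht).ne'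
    field_simp
    linear_combination hode t ht
  set z : ℝ → ℝ := fun s => iterDW t₀ y 1 s / y s - μ
  obtain ⟨d0, e1⟩ := iterDW_succ_of_eqOn (t₀ := t₀) (f := z) (n := 0)
    (g' := fun t => p 2 t - p 1 t * p 1 t) (eqOn_refl z _)
    fun t ht => (hp 1 (by norm_num) t ht).sub_const μ
  obtain ⟨d1, e2⟩ := iterDW_succ_of_eqOn
    (g' := fun t => p 3 t - 3 * p 1 t * p 2 t + 2 * p 1 t ^ 3) e1 fun t ht => by
      have h1 := hp 1 (by norm_num) t ht
      exact ((hp 2 (by norm_num) t ht).sub (h1.mul h1)).congr_deriv (by ring)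
  obtain ⟨d2, e3⟩ := iterDW_succ_of_eqOn
    (g' := fun t => p 4 t - 4 * p 1 t * p 3 t - 3 * p 2 t ^ 2 + 12 * p 1 t ^ 2 * p 2 t
      - 6 * p 1 t ^ 4) e2 fun t ht => by
      have h1 := hp 1 (by norm_num) t ht
      have h2 := hp 2 (by norm_num) t ht
      exact (((hp 3 (by norm_num) t ht).sub ((h1.const_mul 3).mul h2)).add
        ((h1.pow 3).const_mul 2)).congr_deriv (by push_cast; ring)
  refine ⟨fun k hk => ?_, fun t ht => ?_⟩
  · interval_cases k
    exacts [d0, d1, d2]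
  · rw [e3 ht, e2 ht, e1 ht]
    have hy := hode' t ht
    simp only [p]
    linear_combination hy - hμ
end

section
/- Let a₀, a₁, a₂, a₃ ∈ ℝ, let r₀, r₁, r₂, r₃ : [t₀,∞) → ℝ, let λ ∈ ℝ be a root of the quartic λ⁴ + a₃λ³ + a₂λ² + a₁λ + a₀, and let z : [t₀,∞) → ℝ be three times differentiable and satisfy the Riccati-type equation R(λ). Then y(t) := exp(∫_{t₀}^t (λ + z(s)) ds) is four times differentiable, positive, and satisfies the perturbed fourth-order equation on [t₀,∞). -/
open Set MeasureTheory

/-- The integral from `t₀` of a function continuous on `[t₀,∞)` is a one-sided primitive there. -/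
theorem hasDerivWithinAt_integral_Ici {t₀ : ℝ} {w : ℝ → ℝ} (hw : ContinuousOn w (Ici t₀))
    {t : ℝ} (ht : t ∈ Ici t₀) :
    HasDerivWithinAt (fun x => ∫ s in t₀..x, w s) (w t) (Ici t₀) t := by
  have hc : Continuous fun x => w (max t₀ x) :=
    hw.comp_continuous (continuous_const.max continuous_id) fun x => le_max_left t₀ x
  have hext : ∀ x ∈ Ici t₀, w (max t₀ x) = w x := fun x hx => by rw [max_eq_right hx]
  have hint : ∀ x ∈ Ici t₀, ∫ s in t₀..x, w s = ∫ s in t₀..x, w (max t₀ s) := fun x hx =>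
    intervalIntegral.integral_congr fun s hs => by
      rw [uIcc_of_le hx] at hs
      exact (hext s hs.1).symm
  have h := (hc.integral_hasStrictDerivAt t₀ t).hasDerivAt.hasDerivWithinAt (s := Ici t₀)
  rw [hext t ht] at h
  exact h.congr hint (hint t ht)

/-- The next iterated derivative agrees on `[t₀,∞)` with a known derivative of a function
that represents the current one there. -/
theorem iterDW_differentiable_and_eqOn_succ {t₀ : ℝ} {f g g' : ℝ → ℝ} {n : ℕ}
    (heq : EqOn (iterDW t₀ f n) g (Ici t₀))
    (hg : ∀ t ∈ Ici t₀, HasDerivWithinAt g (g' t) (Ici t₀) t) :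
    (∀ t ∈ Ici t₀, DifferentiableWithinAt ℝ (iterDW t₀ f n) (Ici t₀) t) ∧
      EqOn (iterDW t₀ f (n + 1)) g' (Ici t₀) := by
  have h : ∀ t ∈ Ici t₀, HasDerivWithinAt (iterDW t₀ f n) (g' t) (Ici t₀) t :=
    fun t ht => (hg t ht).congr heq (heq ht)
  exact ⟨fun t ht => (h t ht).differentiableWithinAt,
    fun t ht => (h t ht).derivWithin (uniqueDiffOn_Ici t₀ t ht)⟩

/-- if `z` is a three times differentiable solution on `[t₀,∞)` of the
Riccati-type equation `R(λ)` (with `λ` a root of the characteristic quartic), then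
`y(t) = exp(∫_{t₀}^t (λ + z))` is four times differentiable, positive and satisfies the
perturbed fourth-order equation on `[t₀,∞)`. -/
theorem stmt_2 (t₀ a₀ a₁ a₂ a₃ la : ℝ) (r₀ r₁ r₂ r₃ : ℝ → ℝ) (z y : ℝ → ℝ)
    (hla : la ^ 4 + a₃ * la ^ 3 + a₂ * la ^ 2 + a₁ * la + a₀ = 0)
    (hzdiff : ∀ k < 3, ∀ t ∈ Ici t₀, DifferentiableWithinAt ℝ (iterDW t₀ z k) (Ici t₀) t)
    (hric : ∀ t ∈ Ici t₀,
      iterDW t₀ z 3 t + (4 * la + a₃) * iterDW t₀ z 2 t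
        + (6 * la ^ 2 + 3 * a₃ * la + a₂) * iterDW t₀ z 1 t
        + (4 * la ^ 3 + 3 * a₃ * la ^ 2 + 2 * a₂ * la + a₁) * z t
        + r₃ t * iterDW t₀ z 2 t + (3 * la * r₃ t + r₂ t) * iterDW t₀ z 1 t
        + (3 * la ^ 2 * r₃ t + 2 * la * r₂ t + r₁ t) * z t
        + la ^ 3 * r₃ t + la ^ 2 * r₂ t + la * r₁ t + r₀ t
        + 4 * z t * iterDW t₀ z 2 t
        + (12 * la + 3 * a₃ + 3 * r₃ t) * z t * iterDW t₀ z 1 t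
        + 6 * z t ^ 2 * iterDW t₀ z 1 t + 3 * (iterDW t₀ z 1 t) ^ 2
        + (6 * la ^ 2 + 3 * la * a₃ + a₂ + 3 * la * r₃ t + r₂ t) * z t ^ 2
        + (4 * la + a₃ + r₃ t) * z t ^ 3 + z t ^ 4 = 0)
    (hy : y = fun t => Real.exp (∫ s in t₀..t, (la + z s))) :
    (∀ k < 4, ∀ t ∈ Ici t₀, DifferentiableWithinAt ℝ (iterDW t₀ y k) (Ici t₀) t) ∧
    (∀ t ∈ Ici t₀, 0 < y t) ∧
    (∀ t ∈ Ici t₀,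
      iterDW t₀ y 4 t + (a₃ + r₃ t) * iterDW t₀ y 3 t + (a₂ + r₂ t) * iterDW t₀ y 2 t
        + (a₁ + r₁ t) * iterDW t₀ y 1 t + (a₀ + r₀ t) * y t = 0) := by
  have hz : ∀ k < 3, ∀ t ∈ Ici t₀,
      HasDerivWithinAt (iterDW t₀ z k) (iterDW t₀ z (k + 1) t) (Ici t₀) t :=
    fun k hk t ht => (hzdiff k hk t ht).hasDerivWithinAt
  set z₁ := iterDW t₀ z 1
  set z₂ := iterDW t₀ z 2
  set z₃ := iterDW t₀ z 3
  have hz0 : ∀ t ∈ Ici t₀, HasDerivWithinAt z (z₁ t) (Ici t₀) t := hz 0 (by norm_num)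
  have hz1 : ∀ t ∈ Ici t₀, HasDerivWithinAt z₁ (z₂ t) (Ici t₀) t := hz 1 (by norm_num)
  have hz2 : ∀ t ∈ Ici t₀, HasDerivWithinAt z₂ (z₃ t) (Ici t₀) t := hz 2 (by norm_num)
  have hw : ∀ t ∈ Ici t₀, HasDerivWithinAt (fun s => la + z s) (z₁ t) (Ici t₀) t :=
    fun t ht => (hz0 t ht).const_add la
  have hy0 : ∀ t ∈ Ici t₀, HasDerivWithinAt y ((la + z t) * y t) (Ici t₀) t := by
    intro t ht
    subst hy
    exact (hasDerivWithinAt_integral_Ici (fun s hs => (hw s hs).continuousWithinAt) ht).exp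
      |>.congr_deriv (mul_comm _ _)
  have hy1 : ∀ t ∈ Ici t₀, HasDerivWithinAt (fun t => (la + z t) * y t)
      ((z₁ t + (la + z t) ^ 2) * y t) (Ici t₀) t := fun t ht =>
    ((hw t ht).mul (hy0 t ht)).congr_deriv (by ring)
  have hy2 : ∀ t ∈ Ici t₀, HasDerivWithinAt (fun t => (z₁ t + (la + z t) ^ 2) * y t)
      ((z₂ t + 3 * (la + z t) * z₁ t + (la + z t) ^ 3) * y t) (Ici t₀) t := fun t ht =>
    (((hz1 t ht).add ((hw t ht).pow 2)).mul (hy0 t ht)).congr_deriv (by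
      simp; ring)
  have hy3 : ∀ t ∈ Ici t₀, HasDerivWithinAt
      (fun t => (z₂ t + 3 * (la + z t) * z₁ t + (la + z t) ^ 3) * y t)
      ((z₃ t + 4 * (la + z t) * z₂ t + 3 * z₁ t ^ 2 + 6 * (la + z t) ^ 2 * z₁ t
        + (la + z t) ^ 4) * y t) (Ici t₀) t := fun t ht =>
    ((((hz2 t ht).add (((hw t ht).const_mul 3).mul (hz1 t ht))).add ((hw t ht).pow 3)).mul
      (hy0 t ht)).congr_deriv (by simp; ring)
  obtain ⟨d0, e1⟩ := iterDW_differentiable_and_eqOn_succ (n := 0) (f := y) (fun _ _ => rfl) hy0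
  obtain ⟨d1, e2⟩ := iterDW_differentiable_and_eqOn_succ e1 hy1
  obtain ⟨d2, e3⟩ := iterDW_differentiable_and_eqOn_succ e2 hy2
  obtain ⟨d3, e4⟩ := iterDW_differentiable_and_eqOn_succ e3 hy3
  refine ⟨fun k hk => ?_, fun t _ => by rw [hy]; exact Real.exp_pos _, fun t ht => ?_⟩
  · interval_cases k
    exacts [d0, d1, d2, d3]
  · rw [e4 ht, e3 ht, e2 ht, e1 ht]
    linear_combination y t * hric t ht + y t * hla
end

section
/- Let λ₁, λ₂, λ₃, λ₄ be distinct real numbers and let y₁, y₂, y₃, y₄ : [t₀,∞) → ℝ be three times differentiable functions with yᵢ(t) ≠ 0 for all t ≥ t₀ and such that for each i ∈ {1,2,3,4} and each j ∈ {1,2,3}, yᵢ^{(j)}(t)/yᵢ(t) → λᵢ^j as t → ∞. Then the Wronskian W(t) := det(M(t)), where M(t) is the 4×4 matrix with entries M(t)_{j,i} = yᵢ^{(j−1)}(t) (row index j = 1,…,4, column index i = 1,…,4), satisfies W(t)/(y₁(t)y₂(t)y₃(t)y₄(t)) → (λ₂−λ₁)(λ₃−λ₁)(λ₄−λ₁)(λ₃−λ₂)(λ₄−λ₂)(λ₄−λ₃)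 as t → ∞. -/
open Set MeasureTheory Filter Topology

/-- If the columns `a · i` are asymptotic to the columns of a Vandermonde matrix after division by
`c i`, then `det a / ∏ i, c i` tends to the Vandermonde determinant. -/
theorem tendsto_det_div_prod_vandermonde {α : Type*} {l : Filter α} {n : ℕ}
    (a : α → Matrix (Fin n) (Fin n) ℝ) (c : Fin n → α → ℝ) (v : Fin n → ℝ)
    (h : ∀ j i, Tendsto (fun t => a t j i / c i t) l (𝓝 (v i ^ (j : ℕ)))) :
    Tendsto (fun t => (a t).det / ∏ i, c i t) l
      (𝓝 (∏ i, ∏ j ∈ Finset.Ioi i, (v j - v i))) := by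
  have hscale (t : α) : (Matrix.of fun j i => a t j i / c i t).det = (a t).det / ∏ i, c i t := by
    simp_rw [div_eq_inv_mul]
    rw [Matrix.det_mul_row (fun i => (c i t)⁻¹) (a t), Finset.prod_inv_distrib]
  have hmat : Tendsto (fun t => Matrix.of fun j i => a t j i / c i t) l
      (𝓝 (Matrix.vandermonde v).transpose) :=
    tendsto_pi_nhds.2 fun j => tendsto_pi_nhds.2 fun i => h j i
  have hdet := ((continuous_id.matrix_det).tendsto _).comp hmat
  simpa only [Function.comp_def, id, hscale, Matrix.det_transpose, Matrix.det_vandermonde]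
    using hdet

/-- if `y₁,…,y₄` are nonvanishing, three times differentiable on `[t₀,∞)`,
with `yᵢ^{(j)}/yᵢ → λᵢ^j` (`j = 1,2,3`) for pairwise distinct reals `λ₁,…,λ₄`, then the
Wronskian divided by `y₁y₂y₃y₄` tends to the Vandermonde determinant
`(λ₂−λ₁)(λ₃−λ₁)(λ₄−λ₁)(λ₃−λ₂)(λ₄−λ₂)(λ₄−λ₃)`. -/
theorem stmt_5 (t₀ : ℝ) (lam : Fin 4 → ℝ) (y : Fin 4 → ℝ → ℝ)
    (hdist : Function.Injective lam)
    (hdiff : ∀ i, ∀ k < 3, ∀ t ∈ Ici t₀, DifferentiableWithinAt ℝ (iterDW t₀ (y i) k) (Ici t₀) t)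
    (hne : ∀ i, ∀ t ∈ Ici t₀, y i t ≠ 0)
    (hlim : ∀ i, ∀ j : ℕ, 1 ≤ j → j ≤ 3 →
      Tendsto (fun t => iterDW t₀ (y i) j t / y i t) atTop (𝓝 (lam i ^ j))) :
    Tendsto
      (fun t =>
        Matrix.det (Matrix.of fun j i : Fin 4 => iterDW t₀ (y i) (j : ℕ) t)
          / (y 0 t * y 1 t * y 2 t * y 3 t))
      atTop
      (𝓝 ((lam 1 - lam 0) * (lam 2 - lam 0) * (lam 3 - lam 0) * (lam 2 - lam 1)
            * (lam 3 - lam 1) * (lam 3 - lam 2))) := by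
  have key := tendsto_det_div_prod_vandermonde (l := atTop)
    (fun t => Matrix.of fun j i : Fin 4 => iterDW t₀ (y i) (j : ℕ) t) y lam ?_
  · have hprod : ∏ i, ∏ j ∈ Finset.Ioi i, (lam j - lam i) =
        (lam 1 - lam 0) * (lam 2 - lam 0) * (lam 3 - lam 0) * (lam 2 - lam 1)
          * (lam 3 - lam 1) * (lam 3 - lam 2) := by
      have h0 : Finset.Ioi (0 : Fin 4) = {1, 2, 3} := by decide
      have h1 : Finset.Ioi (1 : Fin 4) = {2, 3} := by decide
      have h2 : Finset.Ioi (2 : Fin 4) = {3} := by decide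
      have h3 : Finset.Ioi (3 : Fin 4) = ∅ := by decide
      simp [Fin.prod_univ_four, h0, h1, h2, h3, -mul_eq_mul_right_iff]
      ring
    rw [hprod] at key
    simpa only [Fin.prod_univ_four] using key
  · intro j i
    rcases Nat.eq_zero_or_pos (j : ℕ) with hj | hj
    · simp only [Matrix.of_apply, hj, pow_zero]
      refine tendsto_const_nhds.congr' ?_
      filter_upwards [eventually_ge_atTop t₀] with t ht
      exact (div_self (hne i t ht)).symm
    · exact hlim i j hj (by omega)
end

section
/- Let γ₁, γ₂, γ₃ be distinct negative reals, δγ := (γ₂−γ₁)(γ₃−γ₂)(γ₃−γ₁), c₁ := γ₃−γ₂, c₂ := γ₁−γ₃, c₃ := γ₂−γ₁. Let H : [t₀,∞) → ℝ be continuous such that for each k ∈ {1,2,3}, F_k(t) := ∫_t^∞ e^{−γ_k(t−s)}H(s) ds is absolutely convergent for every t ≥ t₀ and F_k(t) → 0 as t → ∞. Define z(t) := (1/δγ)·(c₁F₁(t) + c₂F₂(t) + c₃F₃(t)). Then the limit as t → ∞ of ∫_{t₀}^t z(τ) dτ + (1/(γ₁γ₂γ₃))·∫_{t₀}^t H(s)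 ds exists and equals (1/δγ)·Σ_{k=1}^{3}(c_k/γ_k)·F_k(t₀). -/
open Set MeasureTheory Filter Topology

/-- The tail integral `F(t) = ∫_t^∞ e^{−g(t−s)}H(s) ds` solves `F' = −gF − H`; this is the
integrated form of that equation. -/
theorem intervalIntegral_expTail {t0 g : ℝ} {H F : ℝ → ℝ} (hg : g ≠ 0)
    (hH : ContinuousOn H (Ici t0))
    (hF : F = fun t => ∫ s in Ioi t, Real.exp (-(g * (t - s))) * H s)
    (hint : IntegrableOn (fun s => Real.exp (-(g * (t0 - s))) * H s) (Ioi t0))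
    {t : ℝ} (ht : t0 ≤ t) :
    IntervalIntegrable F volume t0 t ∧
      ∫ τ in t0..t, F τ = (F t0 - F t - ∫ s in t0..t, H s) / g := by
  set K : ℝ → ℝ := fun s => H (max t0 s) with hK
  have hKc : Continuous K :=
    hH.comp_continuous (by fun_prop) fun s => le_max_left t0 s
  have hKH : ∀ s, t0 ≤ s → K s = H s := fun s hs => by simp [hK, max_eq_right hs]
  have hkernel : ∀ t s : ℝ, Real.exp (-(g * (t - s))) * H s
      = Real.exp (-(g * t)) * (Real.exp (g * s) * H s) := fun t s => by
    rw [← mul_assoc, ← Real.exp_add]; ring_nf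
  have hint' : IntegrableOn (fun s => Real.exp (g * s) * H s) (Ioi t0) := by
    simp only [hkernel] at hint
    have h := hint.const_mul (Real.exp (g * t0))
    simpa only [IntegrableOn, ← mul_assoc, ← Real.exp_add, add_neg_cancel_left] using h
  set C : ℝ := ∫ s in Ioi t0, Real.exp (g * s) * H s with hC
  set E : ℝ → ℝ := fun t =>
    Real.exp (-(g * t)) * (C - ∫ s in t0..t, Real.exp (g * s) * K s) with hE
  have hFE : ∀ t, t0 ≤ t → F t = E t := by
    intro t ht
    have hcongr : ∫ s in t0..t, Real.exp (g * s) * K s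
        = ∫ s in t0..t, Real.exp (g * s) * H s := by
      refine intervalIntegral.integral_congr fun s hs => ?_
      rw [uIcc_of_le ht] at hs
      simp only [hKH s hs.1]
    have hsplit := intervalIntegral.integral_interval_add_Ioi hint'
      (hint'.mono_set (Ioi_subset_Ioi ht))
    simp only [hF, hE, hkernel, integral_const_mul, hcongr, hC]
    rw [← hsplit]
    ring
  have hderiv : ∀ t, HasDerivAt E (-g * E t - K t) t := by
    intro t
    have h1 : HasDerivAt (fun t => ∫ s in t0..t, Real.exp (g * s) * K s)
        (Real.exp (g * t) * K t) t :=
      Continuous.integral_hasStrictDerivAt (by fun_prop) t0 t |>.hasDerivAt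
    have h2 : HasDerivAt (fun t => Real.exp (-(g * t))) (Real.exp (-(g * t)) * -(g * 1)) t :=
      ((hasDerivAt_id t).const_mul g).neg.exp
    have h3 : Real.exp (-(g * t)) * Real.exp (g * t) = 1 := by
      rw [← Real.exp_add, neg_add_cancel, Real.exp_zero]
    refine (h2.mul (h1.const_sub C)).congr_deriv ?_
    simp only [hE]
    linear_combination -K t * h3
  have hEc : Continuous E :=
    continuous_iff_continuousAt.2 fun t => (hderiv t).continuousAt
  have hftc := intervalIntegral.integral_eq_sub_of_hasDerivAt (a := t0) (b := t)
    (fun s _ => hderiv s)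
    (Continuous.intervalIntegrable (by fun_prop) _ _)
  rw [intervalIntegral.integral_sub (Continuous.intervalIntegrable (by fun_prop) _ _)
    (hKc.intervalIntegrable _ _), intervalIntegral.integral_const_mul] at hftc
  have hEF : EqOn E F (uIcc t0 t) := fun s hs => by
    rw [uIcc_of_le ht] at hs
    exact (hFE s hs.1).symm
  have hKH' : EqOn K H (uIcc t0 t) := fun s hs => by
    rw [uIcc_of_le ht] at hs
    exact hKH s hs.1
  rw [intervalIntegral.integral_congr hEF, intervalIntegral.integral_congr hKH',
    ← hFE t ht, ← hFE t0 le_rfl] at hftc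
  refine ⟨(hEc.intervalIntegrable t0 t).congr_uIoo (hEF.mono uIoo_subset_uIcc_self), ?_⟩
  rw [eq_div_iff hg]
  linear_combination -hftc

/-- asymptotic integration of the Green-kernel representation
`z(t) = (1/δγ)(c₁F₁(t) + c₂F₂(t) + c₃F₃(t))`, `F_k(t) = ∫_t^∞ e^{−γ_k(t−s)}H(s) ds`:
`∫_{t₀}^t z + (γ₁γ₂γ₃)⁻¹∫_{t₀}^t H` converges to `(1/δγ)Σ_k (c_k/γ_k)F_k(t₀)`. -/
theorem stmt_16 (t0 g1 g2 g3 c1 c2 c3 : ℝ) (H z F1 F2 F3 : ℝ → ℝ)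
    (hg1 : g1 < 0) (hg2 : g2 < 0) (hg3 : g3 < 0)
    (h12 : g1 ≠ g2) (h13 : g1 ≠ g3) (h23 : g2 ≠ g3)
    (hc1 : c1 = g3 - g2) (hc2 : c2 = g1 - g3) (hc3 : c3 = g2 - g1)
    (hH : ContinuousOn H (Ici t0))
    (hF1 : F1 = fun t => ∫ s in Ioi t, Real.exp (-(g1 * (t - s))) * H s)
    (hF2 : F2 = fun t => ∫ s in Ioi t, Real.exp (-(g2 * (t - s))) * H s)
    (hF3 : F3 = fun t => ∫ s in Ioi t, Real.exp (-(g3 * (t - s))) * H s)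
    (hint1 : ∀ t, t0 ≤ t →
      IntegrableOn (fun s => Real.exp (-(g1 * (t - s))) * H s) (Ioi t))
    (hint2 : ∀ t, t0 ≤ t →
      IntegrableOn (fun s => Real.exp (-(g2 * (t - s))) * H s) (Ioi t))
    (hint3 : ∀ t, t0 ≤ t →
      IntegrableOn (fun s => Real.exp (-(g3 * (t - s))) * H s) (Ioi t))
    (hlim1 : Tendsto F1 atTop (𝓝 0)) (hlim2 : Tendsto F2 atTop (𝓝 0))
    (hlim3 : Tendsto F3 atTop (𝓝 0))
    (hz : z = fun t =>
      ((g2 - g1) * (g3 - g2) * (g3 - g1))⁻¹ * (c1 * F1 t + c2 * F2 t + c3 * F3 t)) :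
    Tendsto
      (fun t => (∫ τ in t0..t, z τ) + (1 / (g1 * g2 * g3)) * ∫ s in t0..t, H s)
      atTop
      (𝓝 (((g2 - g1) * (g3 - g2) * (g3 - g1))⁻¹ *
        (c1 / g1 * F1 t0 + c2 / g2 * F2 t0 + c3 / g3 * F3 t0))) := by
  have d12 : g2 - g1 ≠ 0 := sub_ne_zero.2 h12.symm
  have d13 : g3 - g1 ≠ 0 := sub_ne_zero.2 h13.symm
  have d23 : g3 - g2 ≠ 0 := sub_ne_zero.2 h23.symm
  have hlim : Tendsto (fun t => ((g2 - g1) * (g3 - g2) * (g3 - g1))⁻¹ *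
      (c1 / g1 * (F1 t0 - F1 t) + c2 / g2 * (F2 t0 - F2 t) + c3 / g3 * (F3 t0 - F3 t))) atTop
      (𝓝 (((g2 - g1) * (g3 - g2) * (g3 - g1))⁻¹ *
        (c1 / g1 * (F1 t0 - 0) + c2 / g2 * (F2 t0 - 0) + c3 / g3 * (F3 t0 - 0)))) :=
    ((((hlim1.const_sub _).const_mul _).add ((hlim2.const_sub _).const_mul _)).add
      ((hlim3.const_sub _).const_mul _)).const_mul _
  simp only [sub_zero] at hlim
  refine hlim.congr' ?_
  filter_upwards [eventually_ge_atTop t0] with t ht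
  obtain ⟨i1, e1⟩ := intervalIntegral_expTail hg1.ne hH hF1 (hint1 t0 le_rfl) ht
  obtain ⟨i2, e2⟩ := intervalIntegral_expTail hg2.ne hH hF2 (hint2 t0 le_rfl) ht
  obtain ⟨i3, e3⟩ := intervalIntegral_expTail hg3.ne hH hF3 (hint3 t0 le_rfl) ht
  have hzint : ∫ τ in t0..t, z τ = ((g2 - g1) * (g3 - g2) * (g3 - g1))⁻¹ *
      (c1 * (∫ τ in t0..t, F1 τ) + c2 * (∫ τ in t0..t, F2 τ) + c3 * ∫ τ in t0..t, F3 τ) := by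
    rw [hz, intervalIntegral.integral_const_mul,
      intervalIntegral.integral_add ((i1.const_mul c1).add (i2.const_mul c2)) (i3.const_mul c3),
      intervalIntegral.integral_add (i1.const_mul c1) (i2.const_mul c2)]
    simp only [intervalIntegral.integral_const_mul]
  have hsum : ((g2 - g1) * (g3 - g2) * (g3 - g1))⁻¹ * (c1 / g1 + c2 / g2 + c3 / g3)
      = 1 / (g1 * g2 * g3) := by
    have := hg1.ne
    have := hg2.ne
    have := hg3.ne
    rw [hc1, hc2, hc3]
    field_simp
    ring
  rw [hzint, e1, e2, e3, ← hsum]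
  ring
end
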